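/- arXiv:0809.2590 — 6 statements merged into one kernel-verified Lean document; each statement's English description precedes it below -/
import Mathlib

section
/- Let Ã : ℝ → ℝ and W : ℝ → ℝ be functions such that Ã(v) ≠ 0 for every v ∈ ℝ, and such that for every ε ∈ ℝ both series Σ_{n=0}^{∞} 1/|Ã(ε+4n)| and Σ_{n=0}^{∞} 1/|Ã(ε−4n)| diverge. Then the densely defined symmetric operator T on the Hilbert space ℓ²(ℝ_disc) (square-summable complex families indexed by the set ℝ with counting measure), with domain the finitely supported families and action (Tψ)(v) = Ã(v−2)ψ(v−4) + Ã(v+2)ψ(v+4) − (Ã(v−2)+Ã(v+2))ψ(v) + W(v)ψ(v), is essentially self-adjoint. -/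
open scoped ComplexInnerProductSpace

/-- The dense subspace of finitely supported families in `ℓ²(ℝ_disc, ℂ)`,
the Hilbert space of square-summable complex families indexed by the set `ℝ`
with counting measure. -/
noncomputable def finSuppR : Submodule ℂ (lp (fun _ : ℝ => ℂ) 2) where
  carrier := {ψ | (Function.support fun v => ψ v).Finite}
  add_mem' := by
    intro ψ φ hψ hφ
    refine (hψ.union hφ).subset ?_
    intro v hv
    simp only [Function.mem_support, lp.coeFn_add, Pi.add_apply] at hv
    simp only [Set.mem_union, Function.mem_support]
    by_contra h
    push_neg at h
    exact hv (by rw [h.1, h.2, add_zero])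
  zero_mem' := by
    simp only [Set.mem_setOf_eq]
    refine Set.Finite.subset (Set.finite_empty) ?_
    intro v hv
    simp only [Function.mem_support, lp.coeFn_zero, Pi.zero_apply, ne_eq,
      not_true_eq_false] at hv
  smul_mem' := by
    intro c ψ hψ
    refine hψ.subset ?_
    intro v hv
    simp only [Function.mem_support, lp.coeFn_smul, Pi.smul_apply, smul_eq_mul] at hv
    simp only [Function.mem_support]
    exact fun h => hv (by rw [h, mul_zero])

open scoped ComplexConjugate in
/-- The weighted Wronskian of two families across the lattice edge with midpoint `s`. -/
noncomputable def edgeWronskian (A : ℝ → ℝ) (φ χ : ℝ → ℂ) (s : ℝ) : ℂ :=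
  (A s : ℂ) * (conj (φ (s + 2)) * χ (s - 2) - conj (φ (s - 2)) * χ (s + 2))

/-- `φ'` is the image of `φ` under the formal difference expression with coefficients `A`, `W`. -/
def IsDifferenceImage (A W : ℝ → ℝ) (φ φ' : ℝ → ℂ) : Prop :=
  ∀ v, φ' v = (A (v - 2) : ℂ) * φ (v - 4) + (A (v + 2) : ℂ) * φ (v + 4)
    - ((A (v - 2) : ℂ) + (A (v + 2) : ℂ)) * φ v + (W v : ℂ) * φ v

/-- If the increments of `u` are summable and `u / a` is absolutely summable while `1 / a` is not,
then `u` tends to zero, so its increments sum to `-u 0`. -/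
theorem hasSum_increments_of_not_summable {u : ℕ → ℂ} {a : ℕ → ℝ}
    (ha : ¬ Summable fun n => 1 / |a n|) (hu : Summable fun n => ‖u n‖ / |a n|)
    (hd : Summable fun n => u (n + 1) - u n) :
    HasSum (fun n => u (n + 1) - u n) (-u 0) := by
  obtain ⟨S, hS⟩ := hd
  have hlim : Filter.Tendsto u Filter.atTop (nhds (S + u 0)) := by
    have h := hS.tendsto_sum_nat.add_const (u 0)
    simpa only [Finset.sum_range_sub, sub_add_cancel] using h
  have h0 : S + u 0 = 0 := by
    by_contra hne
    have hpos : 0 < ‖S + u 0‖ := norm_pos_iff.mpr hne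
    have hev : ∀ᶠ n in Filter.atTop, ‖S + u 0‖ / 2 < ‖u n‖ :=
      hlim.norm.eventually (lt_mem_nhds (by linarith))
    refine ha (Summable.of_norm_bounded_eventually_nat
      (g := fun n => 2 / ‖S + u 0‖ * (‖u n‖ / |a n|)) (hu.mul_left _) ?_)
    filter_upwards [hev] with n hn
    rw [Real.norm_of_nonneg (by positivity)]
    have h1 : 1 ≤ 2 / ‖S + u 0‖ * ‖u n‖ := by
      rw [div_mul_eq_mul_div, le_div_iff₀ hpos]
      linarith
    calc 1 / |a n| ≤ (2 / ‖S + u 0‖ * ‖u n‖) / |a n| := by gcongr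
      _ = _ := by ring
  rwa [eq_neg_of_add_eq_zero_left h0] at hS

/-- A summable family on `ℝ` whose sum over each coset of `4ℤ` vanishes has vanishing sum. -/
theorem tsum_eq_zero_of_hasSum_lattice {f : ℝ → ℂ} (hf : Summable f)
    (h : ∀ ε : ℝ, HasSum (fun n : ℤ => f (ε + 4 * n)) 0) : ∑' v, f v = 0 := by
  refine (hf.hasSum.tsum_fiberwise fun v : ℝ => Int.fract (v / 4)).unique ?_
  convert hasSum_zero using 2 with c
  rcases isEmpty_or_nonempty ((fun v : ℝ => Int.fract (v / 4)) ⁻¹' {c}) with hc | ⟨⟨ε, hε⟩⟩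
  · exact tsum_empty
  have hε' : Int.fract (ε / 4) = c := hε
  have hmem (n : ℤ) : ε + 4 * n ∈ (fun v : ℝ => Int.fract (v / 4)) ⁻¹' {c} := by
    simp only [Set.mem_preimage, Set.mem_singleton_iff, ← hε']
    rw [Int.fract_eq_fract]
    exact ⟨n, by ring⟩
  let e : ℤ → (fun v : ℝ => Int.fract (v / 4)) ⁻¹' {c} := fun n => ⟨ε + 4 * n, hmem n⟩
  have he : Function.Bijective e := by
    constructor
    · intro m n hmn
      have : ε + 4 * (m : ℝ) = ε + 4 * n := congrArg Subtype.val hmn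
      exact_mod_cast (by linarith : (m : ℝ) = n)
    · rintro ⟨v, hv⟩
      have hv' : Int.fract (v / 4) = Int.fract (ε / 4) := by rw [hε']; exact hv
      obtain ⟨z, hz⟩ := Int.fract_eq_fract.mp hv'
      exact ⟨z, Subtype.ext (by change ε + 4 * (z : ℝ) = v; linarith)⟩
  rw [← (Equiv.ofBijective e he).tsum_eq]
  exact (h ε).tsum_eq

theorem lp.summable_norm_sq_apply (φ : lp (fun _ : ℝ => ℂ) 2) :
    Summable fun v => ‖φ v‖ ^ 2 := by
  simpa using (lp.memℓp φ).summable (by norm_num)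

theorem summable_norm_edgeWronskian_div {A : ℝ → ℝ} (hA : ∀ v, A v ≠ 0)
    (φ χ : lp (fun _ : ℝ => ℂ) 2) :
    Summable fun s => ‖edgeWronskian A φ χ s‖ / |A s| := by
  have shift (ψ : lp (fun _ : ℝ => ℂ) 2) (c : ℝ) : Summable fun s => ‖ψ (s + c)‖ ^ 2 :=
    (lp.summable_norm_sq_apply ψ).comp_injective (add_left_injective c)
  refine Summable.of_nonneg_of_le (fun s => by positivity) (fun s => ?_)
    (((shift φ 2).add (shift χ (-2))).add ((shift φ (-2)).add (shift χ 2)))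
  rw [edgeWronskian, norm_mul, Complex.norm_real, Real.norm_eq_abs,
    mul_div_cancel_left₀ _ (abs_ne_zero.mpr (hA s))]
  refine (norm_sub_le _ _).trans ?_
  simp only [norm_mul, RCLike.norm_conj, ← sub_eq_add_neg]
  nlinarith [sq_nonneg (‖φ (s + 2)‖ - ‖χ (s - 2)‖), sq_nonneg (‖φ (s - 2)‖ - ‖χ (s + 2)‖),
    sq_nonneg (‖φ (s + 2)‖ + ‖χ (s - 2)‖), sq_nonneg (‖φ (s - 2)‖ + ‖χ (s + 2)‖)]

/-- Green's identity without boundary terms for the difference expression: the divergence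
conditions on `A` make the formal expression symmetric on all square-summable families
whose image is square-summable. -/
theorem IsDifferenceImage.inner_eq {A W : ℝ → ℝ} (hA : ∀ v, A v ≠ 0)
    (hpos : ∀ ε : ℝ, ¬ Summable fun n : ℕ => 1 / |A (ε + 4 * n)|)
    (hneg : ∀ ε : ℝ, ¬ Summable fun n : ℕ => 1 / |A (ε - 4 * n)|)
    {φ φ' χ χ' : lp (fun _ : ℝ => ℂ) 2}
    (hφ : IsDifferenceImage A W φ φ') (hχ : IsDifferenceImage A W χ χ') :
    ⟪φ', χ⟫ = ⟪φ, χ'⟫ := by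
  set w := edgeWronskian A φ χ with hw
  have hl : Summable fun v => inner ℂ (φ' v) (χ v) := lp.summable_inner φ' χ
  have hr : Summable fun v => inner ℂ (φ v) (χ' v) := lp.summable_inner φ χ'
  have hf := hl.sub hr
  have hfw (v : ℝ) : inner ℂ (φ' v) (χ v) - inner ℂ (φ v) (χ' v) = w (v + 2) - w (v - 2) := by
    have e1 : v + 2 + 2 = v + 4 := by ring
    have e2 : v - 2 - 2 = v - 4 := by ring
    rw [RCLike.inner_apply, RCLike.inner_apply, hφ v, hχ v]
    simp only [hw, edgeWronskian, map_add, map_sub, map_mul,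
      Complex.conj_ofReal, e1, e2, add_sub_cancel_right, sub_add_cancel]
    ring
  simp only [hfw] at hf
  have hws : Summable fun s => ‖w s‖ / |A s| := summable_norm_edgeWronskian_div hA φ χ
  rw [← sub_eq_zero, lp.inner_eq_tsum, lp.inner_eq_tsum,
    ← hl.tsum_sub hr]
  simp only [hfw]
  refine tsum_eq_zero_of_hasSum_lattice hf fun ε => ?_
  have injp (c : ℝ) : Function.Injective fun n : ℕ => c + 4 * (n : ℝ) := fun m n hmn => by
    have : c + 4 * (m : ℝ) = c + 4 * n := hmn
    exact_mod_cast (by linarith : (m : ℝ) = n)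
  have injn (c : ℝ) : Function.Injective fun n : ℕ => c - 4 * (n : ℝ) := fun m n hmn => by
    have : c - 4 * (m : ℝ) = c - 4 * n := hmn
    exact_mod_cast (by linarith : (m : ℝ) = n)
  have right : HasSum (fun n : ℕ => w (ε + 4 * n + 2) - w (ε + 4 * n - 2)) (-w (ε - 2)) := by
    have key (n : ℕ) : w (ε + 4 * n + 2) - w (ε + 4 * n - 2)
        = w (ε - 2 + 4 * (n + 1 : ℕ)) - w (ε - 2 + 4 * n) := by
      congr 2 <;> push_cast <;> ring
    have hd := hf.comp_injective (injp ε)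
    simp only [Function.comp_def, key] at hd ⊢
    simpa using hasSum_increments_of_not_summable (u := fun n : ℕ => w (ε - 2 + 4 * n))
      (hpos (ε - 2)) (hws.comp_injective (injp (ε - 2))) hd
  have left : HasSum (fun n : ℕ => w (ε + 4 * (-((n : ℤ) + 1) : ℤ) + 2)
      - w (ε + 4 * (-((n : ℤ) + 1) : ℤ) - 2)) (w (ε - 2)) := by
    have key (n : ℕ) : w (ε + 4 * (-((n : ℤ) + 1) : ℤ) + 2)
        - w (ε + 4 * (-((n : ℤ) + 1) : ℤ) - 2)
        = -(w (ε - 2 - 4 * (n + 1 : ℕ)) - w (ε - 2 - 4 * n)) := by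
      rw [neg_sub]
      congr 2 <;> push_cast <;> ring
    have hd : Summable fun n : ℕ => w (ε - 2 - 4 * (n + 1 : ℕ)) - w (ε - 2 - 4 * n) := by
      refine ((hf.comp_injective (injn (ε - 4))).neg).congr fun n => ?_
      rw [Function.comp_apply, neg_sub]
      congr 2 <;> push_cast <;> ring
    simp only [key]
    simpa using (hasSum_increments_of_not_summable (u := fun n : ℕ => w (ε - 2 - 4 * n))
      (hneg (ε - 2)) (hws.comp_injective (injn (ε - 2))) hd).neg
  have hsum := HasSum.of_nat_of_neg_add_one
    (f := fun n : ℤ => w (ε + 4 * n + 2) - w (ε + 4 * n - 2))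
    (by simpa only [Int.cast_natCast] using right) left
  rwa [neg_add_cancel] at hsum

theorem single_mem_finSuppR (v : ℝ) (c : ℂ) : lp.single 2 v c ∈ finSuppR := by
  refine (Set.finite_singleton v).subset fun u hu => ?_
  by_contra h
  exact hu (lp.single_apply_ne (E := fun _ : ℝ => ℂ) 2 v c h)

theorem dense_finSuppR : Dense (finSuppR : Set (lp (fun _ : ℝ => ℂ) 2)) := fun ψ =>
  mem_closure_of_tendsto (lp.hasSum_single ENNReal.ofNat_ne_top ψ)
    (Filter.Eventually.of_forall fun _ =>
      finSuppR.sum_mem fun v _ => single_mem_finSuppR v (ψ v))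

/-- A vector acting on all images of basis vectors as `φ'` does on the basis vectors is the image
of `φ` under the difference expression. -/
theorem isDifferenceImage_of_inner_single {A W : ℝ → ℝ} {φ φ' : lp (fun _ : ℝ => ℂ) 2}
    (h : ∀ v, ∀ η : lp (fun _ : ℝ => ℂ) 2,
      IsDifferenceImage A W (lp.single 2 v (1 : ℂ) : lp (fun _ : ℝ => ℂ) 2) η →
      ⟪φ', lp.single 2 v (1 : ℂ)⟫ = ⟪φ, η⟫) :
    IsDifferenceImage A W φ φ' := by
  intro v
  let η : lp (fun _ : ℝ => ℂ) 2 := lp.single 2 (v + 4) (A (v + 2) : ℂ)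
    + lp.single 2 (v - 4) (A (v - 2) : ℂ) + lp.single 2 v (W v - (A (v - 2) + A (v + 2)) : ℂ)
  have hη : IsDifferenceImage A W (lp.single 2 v (1 : ℂ) : lp (fun _ : ℝ => ℂ) 2) η := by
    intro u
    simp only [η, lp.coeFn_add, Pi.add_apply, lp.coeFn_single]
    by_cases h1 : u = v
    · subst h1
      simp
      ring
    by_cases h2 : u = v + 4
    · subst h2
      have e1 : v + 4 - 2 = v + 2 := by ring
      have e2 : v + 4 ≠ v - 4 := by intro h; linarith
      have e3 : v + 4 + 4 ≠ v := by intro h; linarith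
      simp [e1, e2, e3]
    by_cases h3 : u = v - 4
    · subst h3
      have e1 : v - 4 + 2 = v - 2 := by ring
      have e2 : v - 4 ≠ v + 4 := by intro h; linarith
      have e3 : v - 4 - 4 ≠ v := by intro h; linarith
      simp [e1, e2, e3]
    have e1 : u - 4 ≠ v := fun h => h2 (by linarith)
    have e2 : u + 4 ≠ v := fun h => h3 (by linarith)
    simp [h1, h2, h3, e1, e2]
  have := h v η hη
  simp only [η, inner_add_right, lp.inner_single_right, RCLike.inner_apply, one_mul] at this
  have := congrArg (starRingEnd ℂ) this
  simp only [map_add, map_sub, map_mul, Complex.conj_conj, Complex.conj_ofReal] at this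
  rw [this]
  ring

/-- The LQC constraint operator `(h₂−h₋₂)Ã(V̂)(h₂−h₋₂) + W(V̂)`, acting on
`ℓ²(ℝ_disc)` by
`(Tψ)(v) = Ã(v−2)ψ(v−4) + Ã(v+2)ψ(v+4) − (Ã(v−2)+Ã(v+2))ψ(v) + W(v)ψ(v)`
on the dense domain of finitely supported families, where `Ã` is nowhere vanishing
and satisfies the Carleman-type divergence condition on every lattice `ε + 4ℤ`
in both directions, is a densely defined symmetric operator which is essentially
self-adjoint (its adjoint is self-adjoint). -/
theorem stmt0 (Atilde W : ℝ → ℝ) (hA : ∀ v : ℝ, Atilde v ≠ 0)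
    (hcarlemanPos : ∀ ε : ℝ, ¬ Summable fun n : ℕ => 1 / |Atilde (ε + 4 * n)|)
    (hcarlemanNeg : ∀ ε : ℝ, ¬ Summable fun n : ℕ => 1 / |Atilde (ε - 4 * n)|)
    (T : lp (fun _ : ℝ => ℂ) 2 →ₗ.[ℂ] lp (fun _ : ℝ => ℂ) 2)
    (hdom : T.domain = finSuppR)
    (hT : ∀ ψ : T.domain, ∀ v : ℝ,
      T ψ v = (Atilde (v - 2) : ℂ) * (ψ : lp (fun _ : ℝ => ℂ) 2) (v - 4)
        + (Atilde (v + 2) : ℂ) * (ψ : lp (fun _ : ℝ => ℂ) 2) (v + 4)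
        - ((Atilde (v - 2) : ℂ) + (Atilde (v + 2) : ℂ))
          * (ψ : lp (fun _ : ℝ => ℂ) 2) v
        + (W v : ℂ) * (ψ : lp (fun _ : ℝ => ℂ) 2) v) :
    Dense (T.domain : Set (lp (fun _ : ℝ => ℂ) 2))
      ∧ (∀ x y : T.domain, ⟪T x, (y : lp (fun _ : ℝ => ℂ) 2)⟫
          = ⟪(x : lp (fun _ : ℝ => ℂ) 2), T y⟫)
      ∧ IsSelfAdjoint T.adjoint := by
  have hdense : Dense (T.domain : Set (lp (fun _ : ℝ => ℂ) 2)) := hdom ▸ dense_finSuppR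
  have hsymm : T.IsFormalAdjoint T := fun x y =>
    IsDifferenceImage.inner_eq hA hcarlemanPos hcarlemanNeg (hT x) (hT y)
  have hadj (x : T.adjoint.domain) :
      IsDifferenceImage Atilde W (x : lp (fun _ : ℝ => ℂ) 2) (T.adjoint x) := by
    refine isDifferenceImage_of_inner_single fun v η hη => ?_
    have hv : lp.single 2 v (1 : ℂ) ∈ T.domain := hdom ▸ single_mem_finSuppR v 1
    have hTv : T ⟨_, hv⟩ = η := lp.ext (funext fun u => (hT ⟨_, hv⟩ u).trans (hη u).symm)
    rw [← hTv]
    exact LinearPMap.adjoint_isFormalAdjoint hdense x ⟨_, hv⟩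
  have hle : T ≤ T.adjoint := hsymm.le_adjoint hdense
  have hdense' : Dense (T.adjoint.domain : Set (lp (fun _ : ℝ => ℂ) 2)) := hdense.mono hle.1
  have hsymm' : T.adjoint.IsFormalAdjoint T.adjoint := fun x y =>
    IsDifferenceImage.inner_eq hA hcarlemanPos hcarlemanNeg (hadj x) (hadj y)
  refine ⟨hdense, hsymm, le_antisymm (LinearPMap.IsFormalAdjoint.le_adjoint hdense ?_)
    (hsymm'.le_adjoint hdense')⟩
  intro x y
  have hxy : T x = T.adjoint ⟨x, hle.1 x.2⟩ := hle.2 rfl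
  rw [hxy]
  exact (LinearPMap.adjoint_isFormalAdjoint hdense').symm ⟨x, hle.1 x.2⟩ y
end

section
/- Let a, b : ℤ → ℝ with a(n) ≠ 0 for all n ∈ ℤ, and suppose Σ_{n≥0} 1/|a(n)| = ∞ and Σ_{n≤0} 1/|a(n)| = ∞. Then the Jacobi operator J on ℓ²(ℤ,ℂ), defined on the dense domain of finitely supported sequences by (Jψ)(n) = a(n−1)ψ(n−1) + b(n)ψ(n) + a(n)ψ(n+1), is a symmetric densely defined operator that is essentially self-adjoint. -/
open scoped ComplexInnerProductSpace

/-- The dense subspace of finitely supported sequences in `ℓ²(ℤ, ℂ)`. -/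
noncomputable def finSuppZ : Submodule ℂ (lp (fun _ : ℤ => ℂ) 2) where
  carrier := {ψ | (Function.support fun n => ψ n).Finite}
  add_mem' := by
    intro ψ φ hψ hφ
    refine (hψ.union hφ).subset ?_
    intro n hn
    simp only [Function.mem_support, lp.coeFn_add, Pi.add_apply] at hn
    simp only [Set.mem_union, Function.mem_support]
    by_contra h
    push_neg at h
    exact hn (by rw [h.1, h.2, add_zero])
  zero_mem' := by
    simp only [Set.mem_setOf_eq]
    refine Set.Finite.subset (Set.finite_empty) ?_
    intro n hn
    simp only [Function.mem_support, lp.coeFn_zero, Pi.zero_apply, ne_eq,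
      not_true_eq_false] at hn
  smul_mem' := by
    intro c ψ hψ
    refine hψ.subset ?_
    intro n hn
    simp only [Function.mem_support, lp.coeFn_smul, Pi.smul_apply, smul_eq_mul] at hn
    simp only [Function.mem_support]
    exact fun h => hn (by rw [h, mul_zero])

open Filter Topology

/-- If `a * g` converges while `g` is summable and `1 / |a|` is not, then the limit is zero. -/
lemma eq_zero_of_tendsto_mul_of_not_summable {a : ℕ → ℝ} {g : ℕ → ℂ} {L : ℂ}
    (ha : ∀ n, a n ≠ 0) (hg : Summable g) (hs : ¬ Summable fun n => 1 / |a n|)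
    (hL : Tendsto (fun n => (a n : ℂ) * g n) atTop (𝓝 L)) : L = 0 := by
  by_contra hne
  have hpos : 0 < ‖L‖ := norm_pos_iff.mpr hne
  have hev : ∀ᶠ n in atTop, ‖L‖ / 2 < ‖(a n : ℂ) * g n‖ :=
    hL.norm.eventually_const_lt (half_lt_self hpos)
  refine hs (Summable.of_norm_bounded_eventually_nat (hg.norm.mul_left (2 / ‖L‖)) ?_)
  filter_upwards [hev] with n hn
  have han : 0 < |a n| := abs_pos.mpr (ha n)
  rw [norm_mul, Complex.norm_real, Real.norm_eq_abs] at hn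
  rw [Real.norm_of_nonneg (by positivity), div_mul_eq_mul_div, div_le_div_iff₀ han hpos]
  linarith

/-- A telescoping series over `ℤ` with increments of `a * g` has sum zero when `g` is summable and
`a` satisfies Carleman's condition in both directions. -/
lemma eq_zero_of_hasSum_telescoping {a : ℤ → ℝ} {g : ℤ → ℂ} {S : ℂ} (ha : ∀ n, a n ≠ 0)
    (hpos : ¬ Summable fun n : ℕ => 1 / |a (n : ℤ)|)
    (hneg : ¬ Summable fun n : ℕ => 1 / |a (-(n : ℤ))|) (hg : Summable g)
    (hS : HasSum (fun n => (a n : ℂ) * g n - (a (n - 1) : ℂ) * g (n - 1)) S) : S = 0 := by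
  let W : ℤ → ℂ := fun n => (a n : ℂ) * g n
  change HasSum (fun n => W n - W (n - 1)) S at hS
  obtain ⟨P, hP⟩ := hS.summable.comp_injective (i := fun n : ℕ => (n : ℤ)) Nat.cast_injective
  obtain ⟨Q, hQ⟩ := hS.summable.comp_injective (i := fun n : ℕ => -((n : ℤ) + 1))
    fun m n h => by simpa using h
  simp only [Function.comp_def] at hP hQ
  have hPQ : S = P + Q := hS.unique (hP.of_nat_of_neg_add_one hQ)
  have hright : Tendsto (fun N : ℕ => W N) atTop (𝓝 (P + W (-1))) := by
    have h := ((tendsto_add_atTop_iff_nat 1).mpr hP.tendsto_sum_nat).add_const (W (-1))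
    refine h.congr fun N => ?_
    have := Finset.sum_range_sub (fun k : ℕ => W ((k : ℤ) - 1)) (N + 1)
    simp only [Nat.cast_add, Nat.cast_one, add_sub_cancel_right, Nat.cast_zero, zero_sub] at this
    rw [this, sub_add_cancel]
  have hleft : Tendsto (fun N : ℕ => W (-N)) atTop (𝓝 (W (-1) - Q)) := by
    refine (tendsto_add_atTop_iff_nat 1).mp ((hQ.tendsto_sum_nat.const_sub (W (-1))).congr ?_)
    intro N
    have := Finset.sum_range_sub' (fun k : ℕ => W (-((k : ℤ) + 1))) N
    simp only [Nat.cast_add, Nat.cast_one, Nat.cast_zero, zero_add] at this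
    simp only [Nat.cast_add, Nat.cast_one, neg_add'] at this ⊢
    rw [this, sub_sub_cancel]
  have h₁ := eq_zero_of_tendsto_mul_of_not_summable (fun n : ℕ => ha n)
    (hg.comp_injective Nat.cast_injective) hpos hright
  have h₂ := eq_zero_of_tendsto_mul_of_not_summable (fun n : ℕ => ha (-n))
    (hg.comp_injective (neg_injective.comp Nat.cast_injective)) hneg hleft
  linear_combination hPQ + h₁ - h₂

lemma lp.summable_mul_comp {ι : Type*} (x y : lp (fun _ : ι => ℂ) 2) {σ τ : ι → ι}
    (hσ : σ.Injective) (hτ : τ.Injective) :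
    Summable fun n => starRingEnd ℂ (x (σ n)) * y (τ n) := by
  have hsq (z : lp (fun _ : ι => ℂ) 2) : Summable fun n => ‖z n‖ ^ 2 := by
    simpa using (memℓp_gen_iff (p := 2) (by norm_num)).mp (lp.memℓp z)
  refine Summable.of_norm_bounded (((hsq x).comp_injective hσ).add ((hsq y).comp_injective hτ)) ?_
  intro n
  simp only [norm_mul, RCLike.norm_conj, Function.comp_apply]
  nlinarith [sq_nonneg (‖x (σ n)‖ - ‖y (τ n)‖), sq_nonneg ‖x (σ n)‖, sq_nonneg ‖y (τ n)‖]

/-- The formal Jacobi difference expression with coefficients `a` and `b`. -/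
def jacobiExpr (a b : ℤ → ℝ) (ψ : ℤ → ℂ) (n : ℤ) : ℂ :=
  (a (n - 1) : ℂ) * ψ (n - 1) + (b n : ℂ) * ψ n + (a n : ℂ) * ψ (n + 1)

/-- Under Carleman's condition the Jacobi expression is symmetric on its maximal domain. -/
lemma inner_eq_of_jacobiExpr {a b : ℤ → ℝ} (ha : ∀ n, a n ≠ 0)
    (hpos : ¬ Summable fun n : ℕ => 1 / |a (n : ℤ)|)
    (hneg : ¬ Summable fun n : ℕ => 1 / |a (-(n : ℤ))|) {x y u v : lp (fun _ : ℤ => ℂ) 2}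
    (hu : ∀ n, u n = jacobiExpr a b x n) (hv : ∀ n, v n = jacobiExpr a b y n) :
    ⟪u, y⟫ = ⟪x, v⟫ := by
  have hS := (lp.hasSum_inner (𝕜 := ℂ) u y).sub (lp.hasSum_inner (𝕜 := ℂ) x v)
  have hinj : Function.Injective fun n : ℤ => n + 1 := add_left_injective 1
  have hg := (lp.summable_mul_comp x y hinj Function.injective_id).sub
    (lp.summable_mul_comp x y Function.injective_id hinj)
  refine sub_eq_zero.mp (eq_zero_of_hasSum_telescoping ha hpos hneg hg ?_)
  refine (congrArg (HasSum · _) (funext fun n => ?_)).mp hS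
  simp only [RCLike.inner_apply, hu, hv, jacobiExpr, map_add, map_mul, Complex.conj_ofReal, id,
    sub_add_cancel]
  ring

lemma single_mem_finSuppZ (n : ℤ) (c : ℂ) :
    lp.single (E := fun _ : ℤ => ℂ) 2 n c ∈ finSuppZ := by
  refine (Set.finite_singleton n).subset fun m hm => ?_
  by_contra h
  exact hm (lp.single_apply_ne (E := fun _ : ℤ => ℂ) 2 n c h)

lemma dense_finSuppZ : Dense (finSuppZ : Set (lp (fun _ : ℤ => ℂ) 2)) := fun ψ =>
  mem_closure_of_tendsto (lp.hasSum_single ENNReal.ofNat_ne_top ψ)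
    (Eventually.of_forall fun _ => Submodule.sum_mem _ fun n _ => single_mem_finSuppZ n (ψ n))

/-- The adjoint of a Jacobi operator acts by the Jacobi expression. -/
lemma adjoint_apply_eq_jacobiExpr {a b : ℤ → ℝ}
    {J : lp (fun _ : ℤ => ℂ) 2 →ₗ.[ℂ] lp (fun _ : ℤ => ℂ) 2} (hdom : J.domain = finSuppZ)
    (hJ : ∀ (ψ : J.domain) (n : ℤ), J ψ n = jacobiExpr a b (ψ : lp (fun _ : ℤ => ℂ) 2) n)
    (y : J.adjoint.domain) (n : ℤ) :
    J.adjoint y n = jacobiExpr a b (y : lp (fun _ : ℤ => ℂ) 2) n := by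
  have hdense : Dense (J.domain : Set (lp (fun _ : ℤ => ℂ) 2)) := hdom ▸ dense_finSuppZ
  let e (m : ℤ) (c : ℂ) : lp (fun _ : ℤ => ℂ) 2 := lp.single 2 m c
  have he : e n 1 ∈ J.domain := hdom ▸ single_mem_finSuppZ n 1
  have hJe : J ⟨e n 1, he⟩ = e (n - 1) (a (n - 1)) + e n (b n) + e (n + 1) (a n) := by
    ext m
    rw [hJ]
    simp only [jacobiExpr, e, lp.coeFn_add, Pi.add_apply, lp.single_apply, Pi.single_apply]
    rcases eq_or_ne m n with rfl | h₁
    · simp [show m ≠ m - 1 by lia]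
    rcases eq_or_ne m (n - 1) with rfl | h₂
    · simp [show n - 1 - 1 ≠ n by lia, show n - 1 ≠ n + 1 by lia]
    rcases eq_or_ne m (n + 1) with rfl | h₃
    · simp [show n + 1 + 1 ≠ n by lia, show n + 1 ≠ n - 1 by lia]
    simp [h₁, h₂, h₃, show m - 1 ≠ n by lia, show m + 1 ≠ n by lia]
  have h := LinearPMap.adjoint_isFormalAdjoint hdense y ⟨e n 1, he⟩
  rw [hJe] at h
  simp only [e, inner_add_right, lp.inner_single_right, RCLike.inner_apply, one_mul] at h
  have h' := congrArg (starRingEnd ℂ) h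
  simpa [jacobiExpr] using h'

/-- The Jacobi operator `(Jψ)(n) = a(n−1)ψ(n−1) + b(n)ψ(n) + a(n)ψ(n+1)` with real
coefficients satisfying Carleman's condition in both directions, defined on the dense
domain of finitely supported sequences in `ℓ²(ℤ, ℂ)`, is a densely defined symmetric
operator which is essentially self-adjoint (its adjoint is self-adjoint). -/
theorem stmt1 (a b : ℤ → ℝ) (ha : ∀ n : ℤ, a n ≠ 0)
    (hcarlemanPos : ¬ Summable fun n : ℕ => 1 / |a (n : ℤ)|)
    (hcarlemanNeg : ¬ Summable fun n : ℕ => 1 / |a (-(n : ℤ))|)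
    (J : lp (fun _ : ℤ => ℂ) 2 →ₗ.[ℂ] lp (fun _ : ℤ => ℂ) 2)
    (hdom : J.domain = finSuppZ)
    (hJ : ∀ ψ : J.domain, ∀ n : ℤ,
      J ψ n = (a (n - 1) : ℂ) * (ψ : lp (fun _ : ℤ => ℂ) 2) (n - 1)
        + (b n : ℂ) * (ψ : lp (fun _ : ℤ => ℂ) 2) n
        + (a n : ℂ) * (ψ : lp (fun _ : ℤ => ℂ) 2) (n + 1)) :
    Dense (J.domain : Set (lp (fun _ : ℤ => ℂ) 2))
      ∧ (∀ x y : J.domain, ⟪J x, (y : lp (fun _ : ℤ => ℂ) 2)⟫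
          = ⟪(x : lp (fun _ : ℤ => ℂ) 2), J y⟫)
      ∧ IsSelfAdjoint J.adjoint := by
  have hJ' : ∀ (ψ : J.domain) (n : ℤ),
      J ψ n = jacobiExpr a b (ψ : lp (fun _ : ℤ => ℂ) 2) n := hJ
  have hdense : Dense (J.domain : Set (lp (fun _ : ℤ => ℂ) 2)) := hdom ▸ dense_finSuppZ
  have hsymm : J.IsFormalAdjoint J := fun x y =>
    inner_eq_of_jacobiExpr ha hcarlemanPos hcarlemanNeg (hJ' x) (hJ' y)
  have hsymm_adj : J.adjoint.IsFormalAdjoint J.adjoint := fun x y =>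
    inner_eq_of_jacobiExpr ha hcarlemanPos hcarlemanNeg
      (adjoint_apply_eq_jacobiExpr hdom hJ' x) (adjoint_apply_eq_jacobiExpr hdom hJ' y)
  have hle : J ≤ J.adjoint := hsymm.le_adjoint hdense
  have hdense_adj : Dense (J.adjoint.domain : Set (lp (fun _ : ℤ => ℂ) 2)) :=
    hdense.mono hle.1
  refine ⟨hdense, hsymm, LinearPMap.isSelfAdjoint_def.mpr (le_antisymm ?_ ?_)⟩
  · refine LinearPMap.IsFormalAdjoint.le_adjoint hdense fun x y => ?_
    have h := (LinearPMap.adjoint_isFormalAdjoint hdense_adj).symm ⟨x, hle.1 x.2⟩ y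
    rwa [← hle.2 (x := x) (y := ⟨x, hle.1 x.2⟩) rfl] at h
  · exact hsymm_adj.le_adjoint hdense_adj
end

section
/- Let a, b : ℤ → ℝ with a(n) ≠ 0 for all n ∈ ℤ, and suppose Σ_{n≥0} 1/|a(n)| = ∞ and Σ_{n≤0} 1/|a(n)| = ∞. Let z ∈ ℂ with Im z ≠ 0. If ψ ∈ ℓ²(ℤ,ℂ) satisfies the recurrence a(n−1)ψ(n−1) + b(n)ψ(n) + a(n)ψ(n+1) = z·ψ(n) for every n ∈ ℤ, then ψ = 0. -/
open Filter in
/-- If `|a| * f` stays above a positive constant along a sequence on which `f` is summable, then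
`1 / |a|` is summable along that sequence. -/
theorem summable_one_div_abs_of_eventually_le_mul {a f : ℕ → ℝ} (ha : ∀ n, a n ≠ 0)
    (hf : Summable f) {c : ℝ} (hc : 0 < c) (h : ∀ᶠ n in atTop, c ≤ |a n| * f n) :
    Summable fun n => 1 / |a n| := by
  refine (hf.mul_left c⁻¹).of_norm_bounded_eventually_nat ?_
  filter_upwards [h] with n hn
  have h_pos : 0 < |a n| := abs_pos.mpr (ha n)
  rw [Real.norm_of_nonneg (by positivity), div_le_iff₀ h_pos, mul_assoc, mul_comm (f n),
    le_inv_mul_iff₀ hc, mul_one]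
  exact hn

/-- The products of neighbouring entries of an `ℓ²` sequence are summable. -/
theorem summable_norm_mul_norm_succ (ψ : lp (fun _ : ℤ => ℂ) 2) :
    Summable fun n : ℤ => ‖ψ n‖ * ‖ψ (n + 1)‖ := by
  have h_sq : Summable fun n : ℤ => ‖ψ n‖ ^ 2 := by
    simpa using (lp.memℓp ψ).summable (by norm_num)
  have h_sq_succ : Summable fun n : ℤ => ‖ψ (n + 1)‖ ^ 2 :=
    h_sq.comp_injective (add_left_injective (1 : ℤ))
  refine (h_sq.add h_sq_succ).of_nonneg_of_le (fun n => by positivity) fun n => ?_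
  nlinarith [sq_nonneg (‖ψ n‖ - ‖ψ (n + 1)‖), sq_nonneg ‖ψ n‖, sq_nonneg ‖ψ (n + 1)‖]

/-- The Wronskian of `ψ` and its complex conjugate, up to a constant factor. -/
noncomputable def jacobiCurrent (a : ℤ → ℝ) (ψ : ℤ → ℂ) (n : ℤ) : ℝ :=
  a n * (starRingEnd ℂ (ψ n) * ψ (n + 1)).im

theorem abs_jacobiCurrent_le (a : ℤ → ℝ) (ψ : ℤ → ℂ) (n : ℤ) :
    |jacobiCurrent a ψ n| ≤ |a n| * (‖ψ n‖ * ‖ψ (n + 1)‖) := by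
  rw [jacobiCurrent, abs_mul]
  gcongr
  simpa using Complex.abs_im_le_norm (starRingEnd ℂ (ψ n) * ψ (n + 1))

/-- Green's identity for a solution of the Jacobi recurrence. -/
theorem jacobiCurrent_sub_jacobiCurrent {a b : ℤ → ℝ} {z : ℂ} {ψ : ℤ → ℂ} {n : ℤ}
    (hψ : (a (n - 1) : ℂ) * ψ (n - 1) + (b n : ℂ) * ψ n + (a n : ℂ) * ψ (n + 1) = z * ψ n) :
    jacobiCurrent a ψ n - jacobiCurrent a ψ (n - 1) = z.im * ‖ψ n‖ ^ 2 := by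
  have h_re := congrArg Complex.re hψ
  have h_im := congrArg Complex.im hψ
  simp only [Complex.add_re, Complex.add_im, Complex.mul_re, Complex.mul_im, Complex.ofReal_re,
    Complex.ofReal_im] at h_re h_im
  rw [Complex.sq_norm, Complex.normSq_apply]
  simp only [jacobiCurrent, sub_add_cancel, Complex.mul_im, Complex.conj_re, Complex.conj_im]
  linear_combination (ψ n).re * h_im - (ψ n).im * h_re


/-- Deficiency-space formulation of essential self-adjointness of the Jacobi operator
`(Jψ)(n) = a(n−1)ψ(n−1) + b(n)ψ(n) + a(n)ψ(n+1)` under Carleman's condition: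
there is no nonzero `ℓ²(ℤ, ℂ)` solution of the formal eigenvalue equation at any
nonreal `z`. -/
theorem stmt2 (a b : ℤ → ℝ) (ha : ∀ n : ℤ, a n ≠ 0)
    (hcarlemanPos : ¬ Summable fun n : ℕ => 1 / |a (n : ℤ)|)
    (hcarlemanNeg : ¬ Summable fun n : ℕ => 1 / |a (-(n : ℤ))|)
    (z : ℂ) (hz : z.im ≠ 0)
    (ψ : lp (fun _ : ℤ => ℂ) 2)
    (hψ : ∀ n : ℤ, (a (n - 1) : ℂ) * ψ (n - 1) + (b n : ℂ) * ψ n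
      + (a n : ℂ) * ψ (n + 1) = z * ψ n) :
    ψ = 0 := by
  set V : ℤ → ℝ := fun n => z.im * jacobiCurrent a ψ n with hV
  have h_step (n : ℤ) : V n - V (n - 1) = z.im ^ 2 * ‖ψ n‖ ^ 2 := by
    linear_combination z.im * jacobiCurrent_sub_jacobiCurrent (hψ n)
  have h_mono : Monotone V := monotone_int_of_le_succ fun n => by
    have h := h_step (n + 1)
    rw [add_sub_cancel_right] at h
    nlinarith [sq_nonneg (z.im * ‖ψ (n + 1)‖)]
  have h_bound (n : ℤ) : |V n| ≤ |a n| * (|z.im| * (‖ψ n‖ * ‖ψ (n + 1)‖)) := by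
    rw [hV, abs_mul, mul_left_comm]
    exact mul_le_mul_of_nonneg_left (abs_jacobiCurrent_le a ψ n) (abs_nonneg _)
  have h_summable := (summable_norm_mul_norm_succ ψ).mul_left |z.im|
  have h_nonpos (m : ℤ) : V m ≤ 0 := by
    by_contra! hm
    refine hcarlemanPos (summable_one_div_abs_of_eventually_le_mul (fun n => ha n)
      (h_summable.comp_injective Nat.cast_injective) hm ?_)
    filter_upwards [Filter.eventually_ge_atTop m.toNat] with n hn
    exact (h_mono (by lia)).trans ((le_abs_self _).trans (h_bound n))
  have h_nonneg (m : ℤ) : 0 ≤ V m := by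
    by_contra! hm
    refine hcarlemanNeg (summable_one_div_abs_of_eventually_le_mul (fun n => ha (-n))
      (h_summable.comp_injective (neg_injective.comp Nat.cast_injective)) (neg_pos.mpr hm) ?_)
    filter_upwards [Filter.eventually_ge_atTop (-m).toNat] with n hn
    exact (neg_le_neg (h_mono (by lia))).trans ((neg_le_abs _).trans (h_bound (-n)))
  ext n
  have h := h_step n
  rw [(h_nonpos n).antisymm (h_nonneg n), (h_nonpos (n - 1)).antisymm (h_nonneg (n - 1)),
    sub_zero, eq_comm] at h
  simpa [hz] using h
end

section
/- Let ρ_c > 0 be a real number. The bounded linear operator ρ̂ on ℓ²(ℤ,ℂ) defined by (ρ̂ψ)(n) = (ρ_c/4)·(2ψ(n) − ψ(n+1) − ψ(n−1)) is self-adjoint and its spectrum equals the closed interval [0, ρ_c]. -/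
/-- Translation by `k` on `ℓ²(ℤ)`. -/
noncomputable def lpShift (k : ℤ) (ψ : lp (fun _ : ℤ => ℂ) 2) : lp (fun _ : ℤ => ℂ) 2 :=
  ⟨fun n => ψ (n + k), by
    have h := lp.memℓp ψ
    rw [memℓp_gen_iff (by norm_num)] at h
    refine (memℓp_gen_iff (by norm_num)).mpr ?_
    exact (Equiv.addRight k).summable_iff.mpr h⟩

theorem lpShift_apply (k : ℤ) (ψ : lp (fun _ : ℤ => ℂ) 2) (n : ℤ) :
    lpShift k ψ n = ψ (n + k) := rfl

theorem inner_lpShift (k : ℤ) (ψ φ : lp (fun _ : ℤ => ℂ) 2) :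
    inner ℂ (lpShift k ψ) φ = inner ℂ ψ (lpShift (-k) φ) := by
  rw [lp.inner_eq_tsum, lp.inner_eq_tsum, ← (Equiv.addRight k).tsum_eq
    fun n => inner ℂ (ψ n) (lpShift (-k) φ n)]
  simp [lpShift_apply]

theorem norm_lpShift (k : ℤ) (ψ : lp (fun _ : ℤ => ℂ) 2) : ‖lpShift k ψ‖ = ‖ψ‖ := by
  have h : lpShift (-k) (lpShift k ψ) = ψ := by
    ext n
    simp [lpShift_apply]
  rw [@norm_eq_sqrt_re_inner ℂ, @norm_eq_sqrt_re_inner ℂ _ _ _ _ ψ, inner_lpShift, h]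

theorem tendsto_coe_lp_cofinite (ψ : lp (fun _ : ℤ => ℂ) 2) :
    Filter.Tendsto (fun n => ψ n) Filter.cofinite (nhds 0) := by
  have h := lp.memℓp ψ
  rw [memℓp_gen_iff (by norm_num)] at h
  have h0 := h.tendsto_cofinite_zero
  rw [tendsto_zero_iff_norm_tendsto_zero]
  have h1 := h0.sqrt
  simpa [Real.sqrt_sq_eq_abs] using h1

/-- The difference equation `u n - w * u (n - 1) = c * δ₀ n` with `‖w‖ = 1`, `c ≠ 0` has no
solution vanishing at infinity. -/
theorem not_tendsto_zero_of_recurrence {u : ℤ → ℂ} {w : ℂ} (hw : ‖w‖ = 1)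
    (hu : ∀ n, n ≠ 0 → u n = w * u (n - 1)) (h0 : u 0 ≠ w * u (-1)) :
    ¬ Filter.Tendsto u Filter.cofinite (nhds 0) := by
  intro ht
  have hnorm : ∀ n, n ≠ 0 → ‖u n‖ = ‖u (n - 1)‖ := fun n hn => by
    rw [hu n hn, norm_mul, hw, one_mul]
  have hpos : ∀ m : ℕ, ‖u m‖ = ‖u 0‖ := fun m => by
    induction m with
    | zero => simp
    | succ k ih =>
      rw [hnorm _ (by omega), ← ih]
      simp
  have hneg : ∀ m : ℕ, ‖u (-1 - m)‖ = ‖u (-1)‖ := fun m => by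
    induction m with
    | zero => simp
    | succ k ih =>
      rw [← ih, hnorm (-1 - k) (by omega)]
      congr 2
      push_cast
      ring
  have key : ∀ (f : ℕ → ℤ) (a : ℂ), Function.Injective f → (∀ m, ‖u (f m)‖ = ‖a‖) → a = 0 := by
    intro f a hf h
    have h1 := (ht.comp (Nat.cofinite_eq_atTop ▸ hf.tendsto_cofinite)).norm
    simp only [Function.comp_def, h, norm_zero] at h1
    exact norm_eq_zero.mp (tendsto_nhds_unique tendsto_const_nhds h1)
  apply h0
  rw [key (fun m => m) _ Nat.cast_injective hpos,
    key (fun m => -1 - m) _ (fun a b hab => by simpa using hab) hneg, mul_zero]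

theorem stmt5 (ρc : ℝ) (hρc : 0 < ρc)
    (T : lp (fun _ : ℤ => ℂ) 2 →L[ℂ] lp (fun _ : ℤ => ℂ) 2)
    (hT : ∀ ψ : lp (fun _ : ℤ => ℂ) 2, ∀ n : ℤ,
      T ψ n = (ρc / 4 : ℂ) * (2 * ψ n - ψ (n + 1) - ψ (n - 1))) :
    IsSelfAdjoint T ∧ spectrum ℂ T = (fun x : ℝ => (x : ℂ)) '' Set.Icc 0 ρc := by
  have hTS : ∀ ψ, T ψ = ((ρc / 4 : ℝ) : ℂ) • ((2 : ℝ) : ℂ) • ψ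
      - ((ρc / 4 : ℝ) : ℂ) • (lpShift 1 ψ + lpShift (-1) ψ) := fun ψ => by
    ext n
    rw [hT]
    change _ = ((ρc / 4 : ℝ) : ℂ) * (((2 : ℝ) : ℂ) * ψ n)
      - ((ρc / 4 : ℝ) : ℂ) * (ψ (n + 1) + ψ (n + -1))
    push_cast
    ring_nf
  have hsa : IsSelfAdjoint T := by
    rw [ContinuousLinearMap.isSelfAdjoint_iff_isSymmetric]
    intro ψ φ
    simp only [ContinuousLinearMap.coe_coe, hTS, inner_sub_left, inner_sub_right, inner_add_left,
      inner_add_right, inner_smul_left, inner_smul_right, inner_lpShift, Complex.conj_ofReal,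
      neg_neg]
    ring
  refine ⟨hsa, Set.Subset.antisymm (fun z hz => ?_) ?_⟩
  · have hre := hsa.mem_spectrum_eq_re hz
    have hnorm : ‖T + algebraMap ℂ _ (-(ρc / 2 : ℂ))‖ ≤ ρc / 2 := by
      refine ContinuousLinearMap.opNorm_le_bound _ (by positivity) fun ψ => ?_
      have h : (T + algebraMap ℂ _ (-(ρc / 2 : ℂ))) ψ
          = -(((ρc / 4 : ℝ) : ℂ) • (lpShift 1 ψ + lpShift (-1) ψ)) := by
        simp only [add_apply, hTS, Algebra.algebraMap_eq_smul_one,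
          smul_apply, one_apply_eq_self]
        push_cast
        module
      rw [h, norm_neg, norm_smul, Complex.norm_real, Real.norm_of_nonneg (by positivity)]
      have := norm_add_le (lpShift 1 ψ) (lpShift (-1) ψ)
      rw [norm_lpShift, norm_lpShift] at this
      nlinarith
    have hne : Nontrivial (lp (fun _ : ℤ => ℂ) 2) :=
      ⟨lp.single 2 0 1, 0, fun h => by simpa using congrArg (fun ψ => ψ 0) h⟩
    have hz' := spectrum.norm_le_norm_of_mem
      ((spectrum.add_mem_add_iff (s := -(ρc / 2 : ℂ))).mpr hz)
    rw [add_comm] at hnorm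
    have hb := hz'.trans hnorm
    rw [hre] at hb
    have hb' : ‖((z.re + -(ρc / 2) : ℝ) : ℂ)‖ ≤ ρc / 2 := by
      push_cast
      exact hb
    rw [Complex.norm_real, Real.norm_eq_abs, abs_le] at hb'
    exact ⟨z.re, ⟨by linarith, by linarith⟩, hre.symm⟩
  · rintro _ ⟨x, ⟨hx0, hx1⟩, rfl⟩
    rw [spectrum.mem_iff]
    intro hunit
    rw [ContinuousLinearMap.isUnit_iff_bijective] at hunit
    obtain ⟨ψ, hψ⟩ := hunit.2 (lp.single 2 0 1)
    have hn : ∀ n, (x : ℂ) * ψ n - (ρc / 4 : ℂ) * (2 * ψ n - ψ (n + 1) - ψ (n - 1))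
        = (lp.single 2 0 (1 : ℂ) : lp (fun _ : ℤ => ℂ) 2) n := fun n => by
      rw [← hψ, ← hT, Algebra.algebraMap_eq_smul_one]
      rfl
    obtain ⟨z, w, hw, hzw, hsum⟩ : ∃ z w : ℂ, ‖w‖ = 1 ∧ w * z = 1 ∧
        (x : ℂ) = (ρc / 4 : ℂ) * (2 - (z + w)) := by
      set θ := Real.arccos (1 - 2 * x / ρc)
      have hc : Real.cos θ = 1 - 2 * x / ρc := by
        have h1 : x / ρc ≤ 1 := (div_le_one hρc).mpr hx1
        have h2 : 0 ≤ x / ρc := by positivity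
        apply Real.cos_arccos <;> rw [mul_div_assoc] <;> linarith
      refine ⟨Complex.exp (-(θ * Complex.I)), Complex.exp (θ * Complex.I),
        Complex.norm_exp_ofReal_mul_I θ, by rw [← Complex.exp_add]; simp, ?_⟩
      have h2 : Complex.exp (-(θ * Complex.I)) + Complex.exp (θ * Complex.I)
          = 2 * ((1 - 2 * x / ρc : ℝ) : ℂ) := by
        rw [← hc, Complex.ofReal_cos, Complex.two_cos, neg_mul, add_comm]
      have : (ρc : ℂ) ≠ 0 := by exact_mod_cast hρc.ne'
      rw [h2]
      push_cast
      field_simp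
      ring
    have hrec : ∀ n, (ρc / 4 : ℂ) * ((ψ (n + 1) - z * ψ n) - w * (ψ (n - 1 + 1) - z * ψ (n - 1)))
        = (lp.single 2 0 (1 : ℂ) : lp (fun _ : ℤ => ℂ) 2) n := fun n => by
      rw [← hn n, hsum, sub_add_cancel]
      linear_combination (ρc / 4 : ℂ) * ψ (n - 1) * hzw
    have hρ : (ρc / 4 : ℂ) ≠ 0 := by
      have : (ρc : ℂ) ≠ 0 := by exact_mod_cast hρc.ne'
      simpa using this
    refine not_tendsto_zero_of_recurrence (u := fun n => ψ (n + 1) - z * ψ n) hw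
      (fun n hn0 => ?_) (fun h => ?_) ?_
    · have h := hrec n
      rw [lp.single_apply_ne _ _ _ hn0] at h
      exact sub_eq_zero.mp ((mul_eq_zero.mp h).resolve_left hρ)
    · have h' := hrec 0
      rw [lp.single_apply_self] at h'
      simp only [zero_sub] at h'
      rw [h, sub_self, mul_zero] at h'
      exact zero_ne_one h'
    · simpa [lpShift_apply] using (tendsto_coe_lp_cofinite (lpShift 1 ψ)).sub
        ((tendsto_coe_lp_cofinite ψ).const_mul z)
end

section
/- Define B_APS(v) = (27/8)·|v|·| |v+1|^{1/3} − |v−1|^{1/3} |³ and Ã_APS(v) = |v|·| |v+1| − |v−1| | for v ∈ ℝ. Then B_APS(v)·Ã_APS(v) → 2 as v → +∞. -/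
/-- The APS inverse-volume correction function of LQC:
`B_APS(v) = (27/8) · |v| · | |v+1|^(1/3) − |v−1|^(1/3) |³`. -/
noncomputable def B_APS (v : ℝ) : ℝ :=
  (27 / 8) * |v| * (abs (|v + 1| ^ ((1 : ℝ) / 3) - |v - 1| ^ ((1 : ℝ) / 3))) ^ (3 : ℕ)

/-- The APS gravitational constraint coefficient function of LQC:
`Ã_APS(v) = |v| · | |v+1| − |v−1| |`. -/
noncomputable def Atilde_APS (v : ℝ) : ℝ :=
  |v| * abs (|v + 1| - |v - 1|)

open Filter Topology in
/-- The symmetric sum `α² + αβ + β²` of `α = (1 + v⁻¹)^(1/3)` and `β = (1 - v⁻¹)^(1/3)` tends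
to `3` as `v → +∞`. -/
lemma tendsto_rpow_third_symm_sum :
    Tendsto (fun v : ℝ => ((1 + v⁻¹) ^ ((1 : ℝ) / 3)) ^ 2
      + (1 + v⁻¹) ^ ((1 : ℝ) / 3) * (1 - v⁻¹) ^ ((1 : ℝ) / 3)
      + ((1 - v⁻¹) ^ ((1 : ℝ) / 3)) ^ 2) atTop (𝓝 3) := by
  have hα : Tendsto (fun v : ℝ => (1 + v⁻¹) ^ ((1 : ℝ) / 3)) atTop (𝓝 1) := by
    simpa using (tendsto_inv_atTop_zero.const_add (1 : ℝ)).rpow_const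
      (p := (1 : ℝ) / 3) (Or.inl (by norm_num))
  have hβ : Tendsto (fun v : ℝ => (1 - v⁻¹) ^ ((1 : ℝ) / 3)) atTop (𝓝 1) := by
    simpa using (tendsto_inv_atTop_zero.const_sub (1 : ℝ)).rpow_const
      (p := (1 : ℝ) / 3) (Or.inl (by norm_num))
  convert ((hα.pow 2).add (hα.mul hβ)).add (hβ.pow 2) using 2
  norm_num

lemma rpow_third_pow_three {x : ℝ} (hx : 0 ≤ x) : (x ^ ((1 : ℝ) / 3)) ^ 3 = x := by
  simpa using Real.rpow_inv_natCast_pow hx (n := 3) (by norm_num)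

lemma B_APS_mul_Atilde_APS_eq {v : ℝ} (hv : 1 < v) :
    B_APS v * Atilde_APS v = 54 / (((1 + v⁻¹) ^ ((1 : ℝ) / 3)) ^ 2
      + (1 + v⁻¹) ^ ((1 : ℝ) / 3) * (1 - v⁻¹) ^ ((1 : ℝ) / 3)
      + ((1 - v⁻¹) ^ ((1 : ℝ) / 3)) ^ 2) ^ 3 := by
  have hv0 : 0 < v := by linarith
  have hinv : v⁻¹ < 1 := inv_lt_one_of_one_lt₀ hv
  have hinv0 : 0 < v⁻¹ := inv_pos.2 hv0
  have ha : (v + 1) ^ ((1 : ℝ) / 3) = v ^ ((1 : ℝ) / 3) * (1 + v⁻¹) ^ ((1 : ℝ) / 3) := by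
    rw [← Real.mul_rpow hv0.le (by linarith), mul_add, mul_inv_cancel₀ hv0.ne', mul_one]
  have hb : (v - 1) ^ ((1 : ℝ) / 3) = v ^ ((1 : ℝ) / 3) * (1 - v⁻¹) ^ ((1 : ℝ) / 3) := by
    rw [← Real.mul_rpow hv0.le (by linarith), mul_sub, mul_inv_cancel₀ hv0.ne', mul_one]
  have hle : (v - 1) ^ ((1 : ℝ) / 3) ≤ (v + 1) ^ ((1 : ℝ) / 3) :=
    Real.rpow_le_rpow (by linarith) (by linarith) (by norm_num)
  have hAt : Atilde_APS v = v * 2 := by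
    rw [Atilde_APS, abs_of_pos hv0, abs_of_pos (by linarith : 0 < v + 1),
      abs_of_pos (by linarith : 0 < v - 1), show v + 1 - (v - 1) = 2 by ring, abs_two]
  rw [hAt, B_APS, abs_of_pos hv0, abs_of_pos (by linarith : 0 < v + 1),
    abs_of_pos (by linarith : 0 < v - 1), abs_of_nonneg (sub_nonneg.2 hle), ha, hb]
  have hc3 := rpow_third_pow_three hv0.le
  have hα3 := rpow_third_pow_three (by linarith : 0 ≤ 1 + v⁻¹)
  have hβ3 := rpow_third_pow_three (by linarith : 0 ≤ 1 - v⁻¹)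
  have hα : 0 < (1 + v⁻¹) ^ ((1 : ℝ) / 3) := Real.rpow_pos_of_pos (by linarith) _
  have hβ : 0 < (1 - v⁻¹) ^ ((1 : ℝ) / 3) := Real.rpow_pos_of_pos (by linarith) _
  generalize (1 + v⁻¹) ^ ((1 : ℝ) / 3) = α at *
  generalize (1 - v⁻¹) ^ ((1 : ℝ) / 3) = β at *
  generalize v ^ ((1 : ℝ) / 3) = c at *
  have hS : 0 < α ^ 2 + α * β + β ^ 2 := by positivity
  have hdiff : (α - β) * (α ^ 2 + α * β + β ^ 2) = 2 * v⁻¹ := by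
    linear_combination hα3 - hβ3
  rw [eq_div_iff (by positivity)]
  calc _ = 27 / 4 * v ^ 2 * c ^ 3 * ((α - β) * (α ^ 2 + α * β + β ^ 2)) ^ 3 := by ring
    _ = 54 := by rw [hc3, hdiff]; field_simp; norm_num

theorem stmt7 :
    Filter.Tendsto (fun v : ℝ => B_APS v * Atilde_APS v) Filter.atTop (nhds 2) := by
  have h := (tendsto_const_nhds (x := (54 : ℝ))).div
    (tendsto_rpow_third_symm_sum.pow 3) (by norm_num)
  rw [show (54 : ℝ) / 3 ^ 3 = 2 by norm_num] at h
  refine h.congr' ?_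
  filter_upwards [Filter.eventually_gt_atTop 1] with v hv
  exact (B_APS_mul_Atilde_APS_eq hv).symm
end

section
/- Let a : ℤ → ℝ with a(n) > 0 for every n ∈ ℤ. If ψ ∈ ℓ²(ℤ,ℂ) satisfies a(n−1)·(ψ(n−1) − ψ(n)) + a(n)·(ψ(n+1) − ψ(n)) = 0 for every n ∈ ℤ, then ψ = 0. -/
open Filter Topology

/-- The coordinates of an element of `ℓ²` tend to zero along the cofinite filter. -/
theorem lp_two_tendsto_cofinite_zero {ι E : Type*} [NormedAddCommGroup E]
    (f : lp (fun _ : ι => E) 2) : Tendsto (fun i => f i) cofinite (𝓝 0) := by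
  have hs : Summable fun i => ‖f i‖ ^ 2 := by
    simpa using (lp.memℓp f).summable (by norm_num)
  have ht := hs.tendsto_cofinite_zero.sqrt
  simp only [Real.sqrt_sq (norm_nonneg _), Real.sqrt_zero] at ht
  exact tendsto_zero_iff_norm_tendsto_zero.mpr ht

/-- A monotone real function on `ℤ` vanishing at both ends vanishes identically. -/
theorem Monotone.eq_zero_of_tendsto_cofinite {f : ℤ → ℝ} (hf : Monotone f)
    (h : Tendsto f cofinite (𝓝 0)) (n : ℤ) : f n = 0 := by
  rw [Int.cofinite_eq, tendsto_sup] at h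
  exact le_antisymm (hf.ge_of_tendsto h.2 n) (hf.le_of_tendsto h.1 n)

/-- A function on `ℤ` that is invariant under the unit shift is constant. -/
theorem Int.eq_apply_zero_of_succ_eq {α : Type*} {f : ℤ → α} (h : ∀ n, f (n + 1) = f n)
    (n : ℤ) : f n = f 0 := by
  induction n using Int.induction_on with
  | zero => rfl
  | succ k ih => rw [h, ih]
  | pred k ih => rw [← ih, ← h (-(k : ℤ) - 1), sub_add_cancel]

/-- A function on `ℤ` vanishing at infinity whose increments are positive multiples of a fixed
complex number vanishes identically. -/
theorem eq_zero_of_mul_sub_eq_const {a : ℤ → ℝ} (ha : ∀ n, 0 < a n) {f : ℤ → ℂ} {c : ℂ}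
    (hc : ∀ n, (a n : ℂ) * (f (n + 1) - f n) = c) (hf : Tendsto f cofinite (𝓝 0)) (n : ℤ) :
    f n = 0 := by
  have hre (n : ℤ) : a n * ((f (n + 1)).re - (f n).re) = c.re := by
    simpa using congrArg Complex.re (hc n)
  have him (n : ℤ) : a n * ((f (n + 1)).im - (f n).im) = c.im := by
    simpa using congrArg Complex.im (hc n)
  let g : ℤ → ℝ := fun n => c.re * (f n).re + c.im * (f n).im
  have hg (n : ℤ) : a n * (g (n + 1) - g n) = c.re ^ 2 + c.im ^ 2 := by
    simp only [g]
    linear_combination c.re * hre n + c.im * him n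
  have hmono : Monotone g := monotone_int_of_le_succ fun n => by
    have : 0 ≤ a n * (g (n + 1) - g n) := by rw [hg]; positivity
    linarith [nonneg_of_mul_nonneg_right this (ha n)]
  have hg0 : Tendsto g cofinite (𝓝 0) := by
    have hcont : Continuous fun z : ℂ => c.re * z.re + c.im * z.im := by fun_prop
    simpa [g, Function.comp_def] using (hcont.tendsto 0).comp hf
  have hsq : c.re ^ 2 + c.im ^ 2 = 0 := by
    rw [← hg 0, hmono.eq_zero_of_tendsto_cofinite hg0, hmono.eq_zero_of_tendsto_cofinite hg0]
    simp
  have hc0 : c = 0 := Complex.ext (by simp only [Complex.zero_re]; nlinarith)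
    (by simp only [Complex.zero_im]; nlinarith)
  have hconst := Int.eq_apply_zero_of_succ_eq (f := f) fun n => by
    have := hc n
    rw [hc0, mul_eq_zero, Complex.ofReal_eq_zero] at this
    exact sub_eq_zero.mp (this.resolve_left (ha n).ne')
  rw [hconst n]
  exact tendsto_nhds_unique (tendsto_const_nhds.congr fun m => (hconst m).symm) hf

/-- The eigenvalue equation `ρ̂ψ = 0` for the LQC energy density operator with strictly
positive lattice multiplier `a` has no nonzero normalizable (ℓ²) solutions:
if `a(n−1)(ψ(n−1) − ψ(n)) + a(n)(ψ(n+1) − ψ(n)) = 0` for all `n`, then `ψ = 0`. -/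
theorem stmt14 (a : ℤ → ℝ) (ha : ∀ n : ℤ, 0 < a n)
    (ψ : lp (fun _ : ℤ => ℂ) 2)
    (hψ : ∀ n : ℤ, (a (n - 1) : ℂ) * (ψ (n - 1) - ψ n)
      + (a n : ℂ) * (ψ (n + 1) - ψ n) = 0) :
    ψ = 0 := by
  have hconst := Int.eq_apply_zero_of_succ_eq
    (f := fun n => (a (n - 1) : ℂ) * (ψ n - ψ (n - 1))) fun n => by
      simp only [add_sub_cancel_right]
      linear_combination hψ n
  refine lp.ext (funext fun n => ?_)
  have hc (n : ℤ) : (a n : ℂ) * (ψ (n + 1) - ψ n) = (a (0 - 1) : ℂ) * (ψ 0 - ψ (0 - 1)) := by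
    simpa only [add_sub_cancel_right] using hconst (n + 1)
  exact eq_zero_of_mul_sub_eq_const ha hc (lp_two_tendsto_cofinite_zero ψ) n
end
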